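/- There exist no real numbers a, τ and ω > 0 such that both ω = a·sin(ωτ) and 3ω = a·sin(3ωτ) hold. -/

import Mathlib

/-- No 3:1 strong resonance: there are no reals `a`, `τ` and `ω > 0` with
`ω = a·sin(ωτ)` and `3ω = a·sin(3ωτ)`. -/
theorem no_three_one_resonance :
    ¬ ∃ (a τ ω : ℝ), 0 < ω ∧ ω = a * Real.sin (ω * τ) ∧
      3 * ω = a * Real.sin (3 * ω * τ) := by
  rintro ⟨a, τ, ω, hω, h₁, h₃⟩
  rw [mul_assoc 3 ω τ, Real.sin_three_mul] at h₃
  have hsq : ω * Real.sin (ω * τ) ^ 2 = 0 := by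
    linear_combination (Real.sin (ω * τ) ^ 2 - 3 / 4) * h₁ + h₃ / 4
  have hsin : Real.sin (ω * τ) = 0 := by
    simpa [hω.ne'] using hsq
  rw [hsin, mul_zero] at h₁
  exact hω.ne' h₁
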